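/- Suppose G and H are connected graphs on n ≥ 2 vertices each with maximum degree at most d. For every family M of bijections, consider the instance 𝓘(X) built from the extension graph X=X(G,H,M), and let δ be the shortest-path metric of the graph 𝒢 of 𝓘(X) in which each edge coming from X has length equal to its length in X and each pendant edge (v,v_T) has length L = log n. Then δ is a semi-metric on V satisfying δ(u_T,v_T)=D(u_T,v_T) for all terminals u_T,v_T ∈ T (so δ is feasible for the metric relaxation), and its relaxation value satisfies Σ_{e∈E} w(e)·δ(e) ≤ |E| ≤ (d+1)·n². -/

import Mathlib

open Finset

noncomputable section

/-- A semi-metric on a type `V`. -/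
def IsSemiMetric {V : Type} (δ : V → V → ℝ) : Prop :=
  (∀ u v, 0 ≤ δ u v) ∧ (∀ u, δ u u = 0) ∧ (∀ u v, δ u v = δ v u) ∧
    ∀ u v w, δ u w ≤ δ u v + δ v w

/-- The length of a walk with respect to edge lengths `ℓ`. -/
def walkCost {V : Type} {Gr : SimpleGraph V} (ℓ : Sym2 V → ℝ) {u v : V} (p : Gr.Walk u v) : ℝ :=
  (p.edges.map ℓ).sum

/-- The shortest-path (semi-)metric of the graph `Gr` with edge lengths `ℓ`. -/
def spDist {V : Type} (Gr : SimpleGraph V) (ℓ : Sym2 V → ℝ) (u v : V) : ℝ :=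
  sInf {r : ℝ | ∃ p : Gr.Walk u v, r = walkCost ℓ p}

/-- `EO` is an orientation of the edges of `G`: it consists of ordered pairs of adjacent
vertices and contains exactly one of the two orientations of every edge of `G`. -/
def IsOrientation {V : Type} (G : SimpleGraph V) (EO : Finset (V × V)) : Prop :=
  (∀ p ∈ EO, G.Adj p.1 p.2) ∧ ∀ a b : V, G.Adj a b → ((a, b) ∈ EO ↔ (b, a) ∉ EO)

variable {VG VH : Type}

/-- The defining relation of the extension graph `X(G,H,M)`: intra-cloud edges coming from
`H`, and inter-cloud matching edges determined by the bijections `M_e`, `e ∈ EG`. -/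
def ExtRel (H : SimpleGraph VH) (EG : Finset (VG × VG)) (M : VG × VG → VH ≃ VH) :
    VG × VH → VG × VH → Prop := fun x y =>
  (x.1 = y.1 ∧ H.Adj x.2 y.2) ∨ ((x.1, y.1) ∈ EG ∧ y.2 = M (x.1, y.1) x.2)

/-- The extension graph `X(G,H,M)` on the vertex set `V_G × V_H`. -/
def ExtGraph (H : SimpleGraph VH) (EG : Finset (VG × VG)) (M : VG × VG → VH ≃ VH) :
    SimpleGraph (VG × VH) := SimpleGraph.fromRel (ExtRel H EG M)

/-- Edge lengths on `X(G,H,M)`: intra-cloud edges have length `(log n)^{1/3}` and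
inter-cloud edges have length `(log n)^{2/3}`. -/
def extLen (n : ℕ) [DecidableEq VG] : Sym2 (VG × VH) → ℝ := fun e =>
  if (Sym2.map Prod.fst e).IsDiag then Real.log n ^ ((1 : ℝ) / 3)
  else Real.log n ^ ((2 : ℝ) / 3)

/-- `D_X`, the shortest-path metric of the extension graph `X(G,H,M)`. -/
def extDist (n : ℕ) [DecidableEq VG] (H : SimpleGraph VH) (EG : Finset (VG × VG))
    (M : VG × VG → VH ≃ VH) : VG × VH → VG × VH → ℝ :=
  spDist (ExtGraph H EG M) (extLen n)

/-- The vertex set of the `0-Extension` instance `𝓘(X)`: the vertices of `X` (`Sum.inl`)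
together with a disjoint copy serving as terminals (`Sum.inr`). -/
abbrev IV (VG VH : Type) : Type := (VG × VH) ⊕ (VG × VH)

/-- The edges of the instance graph `𝒢` of `𝓘(X)`, as oriented pairs: intra-cloud edges
(from an orientation `EH` of `H`), inter-cloud matching edges (from an orientation `EG` of
`G` and the bijections `M`), and the pendant edges `(v, v_T)`. -/
def instEdges [Fintype VG] [Fintype VH] [DecidableEq VG] [DecidableEq VH]
    (EH : Finset (VH × VH)) (EG : Finset (VG × VG)) (M : VG × VG → VH ≃ VH) :
    Finset (IV VG VH × IV VG VH) :=
  ((Finset.univ ×ˢ EH).image fun p => (Sum.inl (p.1, p.2.1), Sum.inl (p.1, p.2.2))) ∪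
    ((EG ×ˢ (Finset.univ : Finset VH)).image fun p =>
      (Sum.inl (p.1.1, p.2), Sum.inl (p.1.2, M p.1 p.2))) ∪
    ((Finset.univ : Finset (VG × VH)).image fun x => (Sum.inl x, Sum.inr x))

/-- The edge weights of `𝓘(X)`: every edge of `X` has weight the reciprocal of its
length, and pendant edges have weight `1/L` with `L = log n`. -/
def instW (n : ℕ) [DecidableEq VG] : IV VG VH × IV VG VH → ℝ := fun p =>
  match p with
  | (Sum.inl x, Sum.inl y) =>
      if x.1 = y.1 then (Real.log n ^ ((1 : ℝ) / 3))⁻¹ else (Real.log n ^ ((2 : ℝ) / 3))⁻¹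
  | (Sum.inl _, Sum.inr _) => (Real.log n)⁻¹
  | _ => 0

/-- The metric on the terminals of `𝓘(X)`: `D(u_T, v_T) = D_X(u,v) + 2L` for `u ≠ v`,
with `L = log n` (extended by `0` on non-terminal arguments). -/
def instD (n : ℕ) [DecidableEq VG] [DecidableEq VH] (H : SimpleGraph VH)
    (EG : Finset (VG × VG)) (M : VG × VG → VH ≃ VH) : IV VG VH → IV VG VH → ℝ := fun a b =>
  match a, b with
  | Sum.inr u, Sum.inr v =>
      if u = v then 0 else extDist n H EG M u v + 2 * Real.log n
  | _, _ => 0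

/-- An integral solution of `𝓘(X)`: a map into the terminals fixing every terminal. -/
def IsIntegralSolution {VG VH : Type} (f : IV VG VH → IV VG VH) : Prop :=
  (∀ v : IV VG VH, ∃ x : VG × VH, f v = Sum.inr x) ∧
    ∀ x : VG × VH, f (Sum.inr x) = Sum.inr x

/-- The cost of an integral solution `f` of `𝓘(X)`. -/
def intCost (n : ℕ) [Fintype VG] [Fintype VH] [DecidableEq VG] [DecidableEq VH]
    (H : SimpleGraph VH) (EH : Finset (VH × VH)) (EG : Finset (VG × VG))
    (M : VG × VG → VH ≃ VH) (f : IV VG VH → IV VG VH) : ℝ :=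
  ∑ p ∈ instEdges EH EG M, instW n p * instD n H EG M (f p.1) (f p.2)

/-- `G` is a Cayley graph of the group `Γ` with respect to `d` generators. -/
def IsCayley {Γ : Type} [Group Γ] (G : SimpleGraph Γ) (d : ℕ) : Prop :=
  ∃ S : Finset Γ, S.card = d ∧ (1 : Γ) ∉ S ∧ (∀ s ∈ S, s⁻¹ ∈ S) ∧
    ∀ a b : Γ, G.Adj a b ↔ a⁻¹ * b ∈ S

/-- Every cycle of `G` has length at least `g`. -/
def GirthAtLeast {V : Type} (G : SimpleGraph V) (g : ℝ) : Prop :=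
  ∀ (v : V) (c : G.Walk v v), c.IsCycle → g ≤ (c.length : ℝ)

/-- `G` has edge expansion at least `h`: every `S` with `|S| ≤ |V|/2` has at least `h·|S|`
edges leaving it (counted as ordered pairs `(u,v)`, `u ∈ S`, `v ∉ S`, `u ~ v`, which
counts each leaving edge exactly once). -/
def EdgeExpansionAtLeast {V : Type} [Fintype V] (G : SimpleGraph V) (h : ℝ) : Prop :=
  ∀ S : Finset V, 2 * S.card ≤ Fintype.card V →
    h * (S.card : ℝ) ≤ ({p : V × V | G.Adj p.1 p.2 ∧ p.1 ∈ S ∧ p.2 ∉ S}.ncard : ℝ)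

/-- The hypotheses on the pair `(G, H)`: both are connected `d`-regular Cayley graphs on
`n` vertices with edge expansion at least `h` and girth at least `γ·log n`. -/
def GoodPair (d : ℕ) (h γ : ℝ) (n : ℕ) {VG VH : Type} [Fintype VG] [Fintype VH]
    [Group VG] [Group VH] (G : SimpleGraph VG) (H : SimpleGraph VH) : Prop :=
  Fintype.card VG = n ∧ Fintype.card VH = n ∧ G.Connected ∧ H.Connected ∧
    (∀ v, (G.neighborSet v).ncard = d) ∧ (∀ v, (H.neighborSet v).ncard = d) ∧
    IsCayley G d ∧ IsCayley H d ∧ EdgeExpansionAtLeast G h ∧ EdgeExpansionAtLeast H h ∧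
    GirthAtLeast G (γ * Real.log n) ∧ GirthAtLeast H (γ * Real.log n)

section Split

variable {VG VH : Type}

/-- The multiset of edges of `G` obtained by projecting a walk of the extension graph to
the graph `G` via `π = Prod.fst` (intra-cloud steps project to loops and are dropped). -/
def projEdges [DecidableEq VG] {X : SimpleGraph (VG × VH)} {a b : VG × VH}
    (p : X.Walk a b) : Multiset (Sym2 VG) :=
  Multiset.filter (fun e => ¬ e.IsDiag)
    (Multiset.map (Sym2.map Prod.fst) (p.edges : Multiset (Sym2 (VG × VH))))

/-- Given, for every edge of a subgraph `G'` of `G`, a multiset of edges of `G`, the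
combined multiset collected along a walk of `G` all of whose edges lie in `G'`. -/
def combinedEdges {V : Type} {G : SimpleGraph V} {G' : G.Subgraph}
    (Q : ∀ {a b : V}, G'.Adj a b → Multiset (Sym2 V)) :
    {u v : V} → (c : G.Walk u v) → (∀ e ∈ c.edges, e ∈ G'.edgeSet) → Multiset (Sym2 V)
  | _, _, SimpleGraph.Walk.nil, _ => 0
  | _, _, @SimpleGraph.Walk.cons _ _ u v w _ p, hmem =>
      Q (SimpleGraph.Subgraph.mem_edgeSet.mp (hmem s(u, v) (by simp))) +
        combinedEdges Q p (fun e he => hmem e (by simp [he]))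

/-- `(f̃, P)` (encoded by the multisets `Q` of edges of the walks `P(e)`) is a
cycle-homeomorphism of `G` with respect to `G'`: for every simple cycle `C` of `G` all of
whose edges lie in `G'`, the set of edges of `G` appearing an odd number of times in the
combined multiset of the walks assigned to the edges of `C` is exactly the edge set of
`C`. -/
def IsCycleHomeo {V : Type} [DecidableEq V] {G : SimpleGraph V} (G' : G.Subgraph)
    (Q : ∀ {a b : V}, G'.Adj a b → Multiset (Sym2 V)) : Prop :=
  ∀ (v : V) (c : G.Walk v v), c.IsCycle →
    ∀ hmem : ∀ e ∈ c.edges, e ∈ G'.edgeSet,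
      {e : Sym2 V | Odd ((combinedEdges Q c hmem).count e)} = {e : Sym2 V | e ∈ c.edges}

end Split

/-- `f̄ : V_{G'} → V_G × V_H` is an `(α, ε)`-split of the extension graph `X(G,H,M)`:
`G'` is a subgraph of `G` with at least `(1−ε)|E_G|` edges; there is a choice `P` of
shortest paths in `X` between the images under `f̄` of the endpoints of each edge of `G'`
whose projections to `G` make `(π ∘ f̄, P_{π∘f̄})` a cycle-homeomorphism of `G` with
respect to `G'`; `D_X(f̄(g₁), f̄(g₂)) < α` for every edge `(g₁,g₂)` of `G'`; and for every
`g ∈ V_{G'}` the shortest path in `G` between `g` and `π(f̄(g))` has at most `ε·log n`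
edges. -/
def IsSplit (n : ℕ) {VG VH : Type} [Fintype VG] [DecidableEq VG] [DecidableEq VH]
    (G : SimpleGraph VG) (H : SimpleGraph VH) (EG : Finset (VG × VG))
    (M : VG × VG → VH ≃ VH) (α ε : ℝ) (G' : G.Subgraph) (fbar : VG → VG × VH) : Prop :=
  (1 - ε) * (G.edgeSet.ncard : ℝ) ≤ (G'.edgeSet.ncard : ℝ) ∧
  (∃ P : ∀ {g₁ g₂ : VG}, G'.Adj g₁ g₂ → (ExtGraph H EG M).Walk (fbar g₁) (fbar g₂),
    (∀ {g₁ g₂ : VG} (hadj : G'.Adj g₁ g₂),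
      walkCost (extLen n) (P hadj) = extDist n H EG M (fbar g₁) (fbar g₂)) ∧
    IsCycleHomeo G' (fun {_ _} hadj => projEdges (P hadj))) ∧
  (∀ {g₁ g₂ : VG}, G'.Adj g₁ g₂ → extDist n H EG M (fbar g₁) (fbar g₂) < α) ∧
  ∀ g ∈ G'.verts, (G.dist g (fbar g).1 : ℝ) ≤ ε * Real.log n

/-- The cloud of a vertex of the instance graph (for a terminal `v_T`, the cloud of `v`). -/
def cloudOf {VG VH : Type} : IV VG VH → VG := fun v =>
  match v with
  | Sum.inl x => x.1
  | Sum.inr x => x.1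

/-- Edge lengths on the instance graph `𝒢` of `𝓘(X)`: every edge coming from `X` keeps
its length in `X` (`(log n)^{1/3}` intra-cloud, `(log n)^{2/3}` inter-cloud) and every
pendant edge `(v, v_T)` has length `L = log n`. -/
def instLen (n : ℕ) {VG VH : Type} [DecidableEq VG] : Sym2 (IV VG VH) → ℝ := fun e =>
  if (Sym2.map Sum.isLeft e).IsDiag then
    (if (Sym2.map cloudOf e).IsDiag then Real.log n ^ ((1 : ℝ) / 3)
      else Real.log n ^ ((2 : ℝ) / 3))
  else Real.log n

/-- The instance graph `𝒢` of `𝓘(X)`, whose edges are the elements of `instEdges`. -/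
def instGraph {VG VH : Type} [Fintype VG] [Fintype VH] [DecidableEq VG] [DecidableEq VH]
    (EH : Finset (VH × VH)) (EG : Finset (VG × VG)) (M : VG × VG → VH ≃ VH) :
    SimpleGraph (IV VG VH) :=
  SimpleGraph.fromRel fun a b => (a, b) ∈ instEdges EH EG M

section ShortestPath

variable {V : Type} {Gr : SimpleGraph V} {ℓ : Sym2 V → ℝ}

theorem walkCost_cons {u v w : V} (h : Gr.Adj u v) (p : Gr.Walk v w) :
    walkCost ℓ (SimpleGraph.Walk.cons h p) = ℓ s(u, v) + walkCost ℓ p := by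
  simp [walkCost]

theorem walkCost_append {u v w : V} (p : Gr.Walk u v) (q : Gr.Walk v w) :
    walkCost ℓ (p.append q) = walkCost ℓ p + walkCost ℓ q := by
  simp [walkCost]

theorem walkCost_reverse {u v : V} (p : Gr.Walk u v) :
    walkCost ℓ p.reverse = walkCost ℓ p := by
  simp [walkCost]

theorem walkCost_nonneg (hℓ : ∀ e, 0 ≤ ℓ e) {u v : V} (p : Gr.Walk u v) :
    0 ≤ walkCost ℓ p := by
  refine List.sum_nonneg fun r hr => ?_
  obtain ⟨e, -, rfl⟩ := List.mem_map.mp hr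
  exact hℓ e

/-- The cost of a walk bounds the increase of any potential along it. -/
theorem sub_le_walkCost {f : V → ℝ} (hf : ∀ a b, Gr.Adj a b → f b - f a ≤ ℓ s(a, b))
    {u v : V} (p : Gr.Walk u v) : f v - f u ≤ walkCost ℓ p := by
  induction p with
  | nil => simp [walkCost]
  | cons h p ih =>
    rw [walkCost_cons]
    linarith [hf _ _ h]

theorem spDist_le_walkCost (hℓ : ∀ e, 0 ≤ ℓ e) {u v : V} (p : Gr.Walk u v) :
    spDist Gr ℓ u v ≤ walkCost ℓ p :=
  csInf_le ⟨0, by rintro _ ⟨q, rfl⟩; exact walkCost_nonneg hℓ q⟩ ⟨p, rfl⟩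

theorem le_spDist (hG : Gr.Preconnected) {u v : V} {c : ℝ}
    (h : ∀ p : Gr.Walk u v, c ≤ walkCost ℓ p) : c ≤ spDist Gr ℓ u v := by
  obtain ⟨p⟩ := hG u v
  refine le_csInf ⟨_, p, rfl⟩ ?_
  rintro _ ⟨q, rfl⟩
  exact h q

theorem spDist_le_of_adj (hℓ : ∀ e, 0 ≤ ℓ e) {u v : V} (h : Gr.Adj u v) :
    spDist Gr ℓ u v ≤ ℓ s(u, v) := by
  simpa [walkCost] using spDist_le_walkCost hℓ h.toWalk

theorem isSemiMetric_spDist (hG : Gr.Preconnected) (hℓ : ∀ e, 0 ≤ ℓ e) :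
    IsSemiMetric (spDist Gr ℓ) := by
  have hnn : ∀ u v, 0 ≤ spDist Gr ℓ u v := fun u v => le_spDist hG (walkCost_nonneg hℓ)
  have hsymm : ∀ u v, spDist Gr ℓ u v ≤ spDist Gr ℓ v u := fun u v =>
    le_spDist hG fun p => by
      rw [← walkCost_reverse]
      exact spDist_le_walkCost hℓ _
  refine ⟨hnn, fun u => le_antisymm ?_ (hnn u u), fun u v => le_antisymm (hsymm u v) (hsymm v u),
    fun u v w => ?_⟩
  · simpa [walkCost] using spDist_le_walkCost hℓ (SimpleGraph.Walk.nil : Gr.Walk u u)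
  · rw [← sub_le_iff_le_add]
    refine le_spDist hG fun p => ?_
    rw [sub_le_comm]
    refine le_spDist hG fun q => ?_
    rw [sub_le_iff_le_add, add_comm, ← walkCost_append]
    exact spDist_le_walkCost hℓ _

end ShortestPath

/-- Twice the number of oriented edges is at most the number of vertices times a degree bound. -/
theorem IsOrientation.two_mul_card_le {V : Type} [Fintype V] [DecidableEq V] {G : SimpleGraph V}
    {EO : Finset (V × V)} (hEO : IsOrientation G EO) {d : ℕ}
    (hd : ∀ v, (G.neighborSet v).ncard ≤ d) : 2 * EO.card ≤ Fintype.card V * d := by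
  classical
  have hdisj : Disjoint EO (EO.image Prod.swap) := by
    rw [Finset.disjoint_left]
    rintro ⟨a, b⟩ h h'
    obtain ⟨⟨c, e⟩, h1, h2⟩ := Finset.mem_image.mp h'
    obtain ⟨rfl, rfl⟩ := Prod.mk.inj h2
    exact (hEO.2 _ _ (hEO.1 _ h)).mp h h1
  have hsub : EO ∪ EO.image Prod.swap ⊆
      (Finset.univ : Finset V).biUnion fun v => (G.neighborFinset v).image (Prod.mk v) := by
    rintro ⟨a, b⟩ h
    simp only [Finset.mem_biUnion, Finset.mem_univ, true_and, Finset.mem_image,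
      SimpleGraph.mem_neighborFinset]
    rcases Finset.mem_union.mp h with h | h
    · exact ⟨a, b, hEO.1 _ h, rfl⟩
    · obtain ⟨⟨c, e⟩, h1, h2⟩ := Finset.mem_image.mp h
      obtain ⟨rfl, rfl⟩ := Prod.mk.inj h2
      exact ⟨_, _, (hEO.1 _ h1).symm, rfl⟩
  have hcard := Finset.card_le_card hsub
  rw [Finset.card_union_of_disjoint hdisj,
    Finset.card_image_of_injective _ Prod.swap_injective, ← two_mul] at hcard
  refine hcard.trans (Finset.card_biUnion_le_card_mul _ _ _ fun v _ => ?_)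
  refine Finset.card_image_le.trans ?_
  have := hd v
  rwa [Set.ncard_eq_toFinset_card'] at this

section Instance

variable [DecidableEq VG] {G : SimpleGraph VG} {H : SimpleGraph VH} {EG : Finset (VG × VG)}
  {EH : Finset (VH × VH)} {M : VG × VG → VH ≃ VH}

theorem extGraph_preconnected (hG : G.Preconnected) (hH : H.Preconnected) [Nonempty VH]
    (hEG : IsOrientation G EG) : (ExtGraph H EG M).Preconnected := by
  have hcloud : ∀ (g : VG) (a b : VH), (ExtGraph H EG M).Reachable (g, a) (g, b) := fun g a b =>
    (hH a b).map (⟨fun h => (g, h), fun {x y} h =>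
      ⟨fun e => h.ne (Prod.mk.inj e).2, Or.inl (Or.inl ⟨rfl, h⟩)⟩⟩ : H →g ExtGraph H EG M)
  have hstep : ∀ p ∈ EG, ∀ h : VH, (ExtGraph H EG M).Adj (p.1, h) (p.2, M p h) := fun p hp h =>
    ⟨fun e => (hEG.1 p hp).ne (Prod.mk.inj e).1, Or.inl (Or.inr ⟨hp, rfl⟩)⟩
  have hadj : ∀ g g', G.Adj g g' → ∀ a b, (ExtGraph H EG M).Reachable (g, a) (g', b) := by
    intro g g' h a b
    by_cases hm : (g, g') ∈ EG
    · exact (hstep _ hm a).reachable.trans (hcloud _ _ _)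
    · have hm' : (g', g) ∈ EG := (hEG.2 _ _ h.symm).mpr hm
      exact (hcloud g a _).trans (hstep _ hm' b).symm.reachable
  rintro ⟨g, a⟩ ⟨g', b⟩
  obtain ⟨p⟩ := hG g g'
  induction p generalizing a with
  | nil => exact hcloud _ _ _
  | cons h p ih => exact (hadj _ _ h a a).trans (ih a)

theorem extLen_nonneg (n : ℕ) (e : Sym2 (VG × VH)) : 0 ≤ extLen n e := by
  unfold extLen
  split_ifs <;> exact Real.rpow_nonneg (Real.log_natCast_nonneg n) _

theorem instLen_nonneg (n : ℕ) (e : Sym2 (IV VG VH)) : 0 ≤ instLen n e := by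
  unfold instLen
  split_ifs <;> first
    | exact Real.rpow_nonneg (Real.log_natCast_nonneg n) _
    | exact Real.log_natCast_nonneg n

theorem instLen_map_inl (n : ℕ) (e : Sym2 (VG × VH)) :
    instLen n (Sym2.map Sum.inl e) = extLen n e := by
  induction e with
  | h x y => simp [instLen, extLen, cloudOf]

theorem instLen_inl_inr (n : ℕ) (x y : VG × VH) :
    instLen n s(Sum.inl x, Sum.inr y) = Real.log n := by
  simp [instLen]

theorem instW_nonneg (n : ℕ) (p : IV VG VH × IV VG VH) : 0 ≤ instW n p := by
  have hL : (0 : ℝ) ≤ Real.log n := Real.log_natCast_nonneg n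
  unfold instW
  split
  · split_ifs <;> positivity
  · positivity
  · exact le_rfl

variable [Fintype VG] [Fintype VH] [DecidableEq VH]

theorem inl_inl_mem_instEdges {x y : VG × VH} :
    ((Sum.inl x, Sum.inl y) : IV VG VH × IV VG VH) ∈ instEdges EH EG M ↔
      (x.1 = y.1 ∧ (x.2, y.2) ∈ EH) ∨ ((x.1, y.1) ∈ EG ∧ y.2 = M (x.1, y.1) x.2) := by
  obtain ⟨g, h⟩ := x
  obtain ⟨g', h'⟩ := y
  simp only [instEdges, Finset.mem_union, Finset.mem_image, Finset.mem_product, Finset.mem_univ,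
    true_and, and_true, Prod.mk.injEq, Sum.inl.injEq, reduceCtorEq, and_false, exists_false,
    or_false, Prod.exists]
  constructor
  · rintro (⟨a, b, c, hm, ⟨rfl, rfl⟩, rfl, rfl⟩ | ⟨a, b, c, hm, ⟨rfl, rfl⟩, rfl, rfl⟩)
    · exact Or.inl ⟨rfl, hm⟩
    · exact Or.inr ⟨hm, rfl⟩
  · rintro (⟨rfl, hm⟩ | ⟨hm, rfl⟩)
    · exact Or.inl ⟨_, _, _, hm, ⟨rfl, rfl⟩, rfl, rfl⟩
    · exact Or.inr ⟨_, _, _, hm, ⟨rfl, rfl⟩, rfl, rfl⟩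

theorem inl_inr_mem_instEdges {x y : VG × VH} :
    ((Sum.inl x, Sum.inr y) : IV VG VH × IV VG VH) ∈ instEdges EH EG M ↔ x = y := by
  simp [instEdges]

theorem inr_notMem_instEdges {x : VG × VH} {b : IV VG VH} :
    ((Sum.inr x, b) : IV VG VH × IV VG VH) ∉ instEdges EH EG M := by
  simp [instEdges]

theorem instGraph_adj_inl (hEH : IsOrientation H EH) {x y : VG × VH} :
    (instGraph EH EG M).Adj (Sum.inl x) (Sum.inl y) ↔ (ExtGraph H EG M).Adj x y := by
  have h1 : H.Adj x.2 y.2 ↔ ((x.2, y.2) ∈ EH ∨ (y.2, x.2) ∈ EH) :=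
    ⟨fun h => by have := hEH.2 _ _ h; tauto,
      fun h => h.elim (fun h => hEH.1 _ h) fun h => (hEH.1 _ h).symm⟩
  simp only [instGraph, ExtGraph, SimpleGraph.fromRel_adj, inl_inl_mem_instEdges, ExtRel,
    H.adj_comm y.2 x.2, h1, eq_comm (a := y.1) (b := x.1), ne_eq, Sum.inl.injEq]
  tauto

theorem instGraph_adj_inl_inr {x y : VG × VH} :
    (instGraph EH EG M).Adj (Sum.inl x) (Sum.inr y) ↔ x = y := by
  simp [instGraph, inl_inr_mem_instEdges, inr_notMem_instEdges]

theorem not_instGraph_adj_inr_inr {x y : VG × VH} :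
    ¬ (instGraph EH EG M).Adj (Sum.inr x) (Sum.inr y) := by
  simp [instGraph, inr_notMem_instEdges]

/-- The inclusion of the extension graph into the instance graph. -/
def extInl (hEH : IsOrientation H EH) : ExtGraph H EG M →g instGraph EH EG M :=
  ⟨Sum.inl, fun h => (instGraph_adj_inl hEH).mpr h⟩

theorem instGraph_preconnected (hX : (ExtGraph H EG M).Preconnected) (hEH : IsOrientation H EH) :
    (instGraph EH EG M).Preconnected := by
  have hinl : ∀ a : IV VG VH, ∃ x, (instGraph EH EG M).Reachable a (Sum.inl x) := by
    rintro (x | x)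
    · exact ⟨x, .refl _⟩
    · exact ⟨x, (instGraph_adj_inl_inr.mpr rfl).symm.reachable⟩
  intro a b
  obtain ⟨x, hx⟩ := hinl a
  obtain ⟨y, hy⟩ := hinl b
  exact (hx.trans ((hX x y).map (extInl hEH))).trans hy.symm

theorem spDist_inst_inl_le (n : ℕ) (hX : (ExtGraph H EG M).Preconnected)
    (hEH : IsOrientation H EH) (u v : VG × VH) :
    spDist (instGraph EH EG M) (instLen n) (Sum.inl u) (Sum.inl v) ≤ extDist n H EG M u v := by
  refine le_spDist hX fun p => ?_
  refine (spDist_le_walkCost (instLen_nonneg n) (p.map (extInl hEH))).trans_eq ?_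
  simp only [walkCost, SimpleGraph.Walk.edges_map, List.map_map]
  congr 2
  funext e
  exact instLen_map_inl n e

theorem spDist_inst_inr (n : ℕ) (hX : (ExtGraph H EG M).Preconnected)
    (hEH : IsOrientation H EH) (u v : VG × VH) :
    spDist (instGraph EH EG M) (instLen n) (Sum.inr u) (Sum.inr v) =
      instD n H EG M (Sum.inr u) (Sum.inr v) := by
  have hI := instGraph_preconnected hX hEH
  obtain ⟨-, h0, hsymm, htri⟩ := isSemiMetric_spDist hI (instLen_nonneg n)
  obtain ⟨-, hX0, hXsymm, hXtri⟩ := isSemiMetric_spDist hX (extLen_nonneg n)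
  by_cases huv : u = v
  · simp [huv, instD, h0]
  have hL : (0 : ℝ) ≤ Real.log n := Real.log_natCast_nonneg n
  simp only [instD, huv, if_false]
  refine le_antisymm ?_ (le_spDist hI fun p => ?_)
  · have hpend : ∀ x : VG × VH,
        spDist (instGraph EH EG M) (instLen n) (Sum.inl x) (Sum.inr x) ≤ Real.log n := fun x =>
      (spDist_le_of_adj (instLen_nonneg n) (instGraph_adj_inl_inr.mpr rfl)).trans_eq
        (instLen_inl_inr n x x)
    have h1 := htri (Sum.inr u) (Sum.inl u) (Sum.inr v)
    have h2 := htri (Sum.inl u) (Sum.inl v) (Sum.inr v)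
    have h3 := hsymm (Sum.inr u) (Sum.inl u)
    linarith [hpend u, hpend v, spDist_inst_inl_le n hX hEH u v]
  · let f : IV VG VH → ℝ := Sum.elim (extDist n H EG M u)
      fun x => if x = u then -Real.log n else extDist n H EG M u x + Real.log n
    have hu0 : extDist n H EG M u u = 0 := hX0 u
    have hf : ∀ a b, (instGraph EH EG M).Adj a b → f b - f a ≤ instLen n s(a, b) := by
      rintro (x | x) (y | y) h
      · have hxy := spDist_le_of_adj (extLen_nonneg n) ((instGraph_adj_inl hEH).mp h)
        rw [← instLen_map_inl] at hxy
        have := hXtri u x y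
        simp only [f, Sum.elim_inl, extDist, Sym2.map_mk] at hxy ⊢
        linarith
      · obtain rfl := instGraph_adj_inl_inr.mp h
        rw [instLen_inl_inr]
        simp only [f, Sum.elim_inl, Sum.elim_inr]
        split_ifs with hx
        · rw [hx, hu0]; linarith
        · linarith
      · obtain rfl := instGraph_adj_inl_inr.mp h.symm
        rw [Sym2.eq_swap, instLen_inl_inr]
        simp only [f, Sum.elim_inl, Sum.elim_inr]
        split_ifs with hx
        · rw [hx, hu0]; linarith
        · linarith
      · exact absurd h not_instGraph_adj_inr_inr
    have := sub_le_walkCost hf p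
    simp only [f, Sum.elim_inr, if_true, if_neg (Ne.symm huv)] at this
    linarith

/-- On every edge of the instance, the weight is the reciprocal of the length. -/
theorem instW_mul_instLen {n : ℕ} (hn : 2 ≤ n) {p : IV VG VH × IV VG VH}
    (hp : p ∈ instEdges EH EG M) : instW n p * instLen n s(p.1, p.2) = 1 := by
  have hL : 0 < Real.log n := Real.log_pos (by exact_mod_cast hn)
  obtain ⟨x | x, y | y⟩ := p
  · have h3 := (Real.rpow_pos_of_pos hL ((1 : ℝ) / 3)).ne'
    have h4 := (Real.rpow_pos_of_pos hL ((2 : ℝ) / 3)).ne'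
    by_cases h : x.1 = y.1
    · simpa [instW, instLen, cloudOf, h] using inv_mul_cancel₀ h3
    · simpa [instW, instLen, cloudOf, h] using inv_mul_cancel₀ h4
  · rw [instLen_inl_inr]
    exact inv_mul_cancel₀ hL.ne'
  all_goals exact absurd hp inr_notMem_instEdges

theorem instGraph_adj_of_mem (hEG : IsOrientation G EG) (hEH : IsOrientation H EH)
    {p : IV VG VH × IV VG VH} (hp : p ∈ instEdges EH EG M) :
    (instGraph EH EG M).Adj p.1 p.2 := by
  refine ⟨?_, Or.inl hp⟩
  obtain ⟨x | x, y | y⟩ := p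
  · rintro ⟨⟩
    rcases inl_inl_mem_instEdges.mp hp with h | h
    · exact (hEH.1 _ h.2).ne rfl
    · exact (hEG.1 _ h.1).ne rfl
  all_goals simp
  all_goals exact absurd hp inr_notMem_instEdges

theorem card_instEdges_le {n d : ℕ} (hcardG : Fintype.card VG = n) (hcardH : Fintype.card VH = n)
    (hGdeg : ∀ v, (G.neighborSet v).ncard ≤ d) (hHdeg : ∀ v, (H.neighborSet v).ncard ≤ d)
    (hEG : IsOrientation G EG) (hEH : IsOrientation H EH) :
    (instEdges EH EG M).card ≤ (d + 1) * n ^ 2 := by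
  have hG := hEG.two_mul_card_le hGdeg
  have hH := hEH.two_mul_card_le hHdeg
  rw [hcardG] at hG
  rw [hcardH] at hH
  have h : (instEdges EH EG M).card ≤ n * EH.card + EG.card * n + n * n := by
    refine (Finset.card_union_le _ _).trans (add_le_add
      ((Finset.card_union_le _ _).trans (add_le_add ?_ ?_)) ?_) <;>
    · refine Finset.card_image_le.trans ?_
      simp [Finset.card_product, hcardG, hcardH]
  nlinarith [Nat.mul_le_mul_left n hG, Nat.mul_le_mul_left n hH]

end Instance

/-- The fractional solution: for any realization of the extension (any family `M` of
bijections), the shortest-path metric `δ` of the instance graph `𝒢` of `𝓘(X)` — where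
each edge coming from `X` has its length in `X` and each pendant edge has length
`L = log n` — is a semi-metric agreeing with `D` on the terminals (hence feasible for the
metric relaxation), and its relaxation value is at most `|E| ≤ (d+1)·n²`. -/
theorem fractional_solution_bound (n d : ℕ) (hn : 2 ≤ n)
    (VG VH : Type) [Fintype VG] [Fintype VH] [DecidableEq VG] [DecidableEq VH]
    (G : SimpleGraph VG) (H : SimpleGraph VH)
    (hcardG : Fintype.card VG = n) (hcardH : Fintype.card VH = n)
    (hGconn : G.Connected) (hHconn : H.Connected)
    (hGdeg : ∀ v, (G.neighborSet v).ncard ≤ d) (hHdeg : ∀ v, (H.neighborSet v).ncard ≤ d)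
    (EG : Finset (VG × VG)) (hEG : IsOrientation G EG)
    (EH : Finset (VH × VH)) (hEH : IsOrientation H EH)
    (M : VG × VG → VH ≃ VH) :
    IsSemiMetric (spDist (instGraph EH EG M) (instLen n)) ∧
      (∀ u v : VG × VH,
        spDist (instGraph EH EG M) (instLen n) (Sum.inr u) (Sum.inr v) =
          instD n H EG M (Sum.inr u) (Sum.inr v)) ∧
      (∑ p ∈ instEdges EH EG M,
          instW n p * spDist (instGraph EH EG M) (instLen n) p.1 p.2 ≤
        ((instEdges EH EG M).card : ℝ)) ∧
      (instEdges EH EG M).card ≤ (d + 1) * n ^ 2 := by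
  have : Nonempty VH := hHconn.nonempty
  have hX : (ExtGraph H EG M).Preconnected :=
    extGraph_preconnected hGconn.preconnected hHconn.preconnected hEG
  refine ⟨isSemiMetric_spDist (instGraph_preconnected hX hEH) (instLen_nonneg n),
    spDist_inst_inr n hX hEH, ?_, card_instEdges_le hcardG hcardH hGdeg hHdeg hEG hEH⟩
  rw [Finset.cast_card]
  refine Finset.sum_le_sum fun p hp => ?_
  rw [← instW_mul_instLen hn hp]
  exact mul_le_mul_of_nonneg_left
    (spDist_le_of_adj (instLen_nonneg n) (instGraph_adj_of_mem hEG hEH hp)) (instW_nonneg n p)
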